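/- For all integers n ≥ 1 and 0 ≤ m < n, the number of ascent sequences of length n with exactly m ascents avoiding both 0010 and 0021 equals the number of ascent sequences of length n with exactly m ascents avoiding both 0011 and 0021; i.e., S_{n,m}(0010,0021) = S_{n,m}(0011,0021). -/

import Mathlib

/-- The number of ascents of a word of nonnegative integers. -/
def numAscents (w : List ℕ) : ℕ :=
  (w.zip w.tail).countP (fun p => p.1 < p.2)

/-- A word of nonnegative integers is an ascent sequence if it starts with 0 and
each subsequent entry is at most one more than the number of ascents preceding it. -/
def IsAscentSeq (w : List ℕ) : Prop :=
  w.head? = some 0 ∧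
    ∀ i (h : i < w.length), 1 ≤ i → w.get ⟨i, h⟩ ≤ numAscents (w.take i) + 1

/-- A word `π` contains the pattern `τ` if it has a subsequence order-isomorphic to `τ`. -/
def Contains (π τ : List ℕ) : Prop :=
  ∃ f : Fin τ.length → Fin π.length, StrictMono f ∧
    ∀ i j, (π.get (f i) < π.get (f j) ↔ τ.get i < τ.get j) ∧
      (π.get (f i) > π.get (f j) ↔ τ.get i > τ.get j)

/-- A word avoids a pattern if it does not contain it. -/
def Avoids (π τ : List ℕ) : Prop := ¬ Contains π τ

/-- The number of ascent sequences of length `n` with exactly `m` ascents avoiding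
every pattern in `T`. -/
noncomputable def avoiderCountAsc (n m : ℕ) (T : List (List ℕ)) : ℕ :=
  {w : List ℕ | w.length = n ∧ IsAscentSeq w ∧ numAscents w = m ∧ ∀ τ ∈ T, Avoids w τ}.ncard

theorem append_singleton_sublist_append_singleton {α : Type*} {l w : List α} {c x : α} :
    (l ++ [c]).Sublist (w ++ [x]) ↔ (l ++ [c]).Sublist w ∨ c = x ∧ l.Sublist w := by
  rw [← List.reverse_sublist, ← List.reverse_sublist (l₁ := l ++ [c]),
    ← List.reverse_sublist (l₁ := l)]
  simp only [List.reverse_append, List.reverse_cons, List.reverse_nil, List.nil_append,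
    List.singleton_append]
  exact List.cons_sublist_cons'

theorem numAscents_cons_cons (a b : ℕ) (l : List ℕ) :
    numAscents (a :: b :: l) = (if a < b then 1 else 0) + numAscents (b :: l) := by
  simp [numAscents, List.countP_cons, add_comm]

theorem numAscents_append_pair (u : List ℕ) (p x : ℕ) :
    numAscents (u ++ [p] ++ [x]) = numAscents (u ++ [p]) + if p < x then 1 else 0 := by
  induction u with
  | nil => simp [numAscents, List.countP_cons]
  | cons a u ih =>
    cases u with
    | nil =>
      simp only [List.nil_append, List.cons_append] at ih ⊢
      rw [numAscents_cons_cons, ih, numAscents_cons_cons]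
      omega
    | cons b u =>
      simp only [List.cons_append] at ih ⊢
      rw [numAscents_cons_cons, ih, numAscents_cons_cons]
      omega

theorem isAscentSeq_append_singleton {u : List ℕ} (hu : u ≠ []) (x : ℕ) :
    IsAscentSeq (u ++ [x]) ↔ IsAscentSeq u ∧ x ≤ numAscents u + 1 := by
  have hpos : 0 < u.length := List.length_pos_iff.2 hu
  have hhead : (u ++ [x]).head? = u.head? := by
    cases u with
    | nil => exact absurd rfl hu
    | cons a l => rfl
  unfold IsAscentSeq
  rw [hhead]
  simp only [List.get_eq_getElem]
  constructor
  · rintro ⟨h0, h⟩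
    refine ⟨⟨h0, fun i hi h1 => ?_⟩, ?_⟩
    · have := h i (by simp; omega) h1
      rwa [List.getElem_append_left hi, List.take_append_of_le_length hi.le] at this
    · simpa using h u.length (by simp) hpos
  · rintro ⟨⟨h0, h⟩, hx⟩
    refine ⟨h0, fun i hi h1 => ?_⟩
    rcases Nat.lt_or_ge i u.length with hlt | hge
    · rw [List.getElem_append_left hlt, List.take_append_of_le_length hlt.le]
      exact h i hlt h1
    · obtain rfl : i = u.length := by simp at hi; omega
      simpa using hx

theorem contains_four_iff (w : List ℕ) (t₀ t₁ t₂ t₃ : ℕ) :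
    Contains w [t₀, t₁, t₂, t₃] ↔ ∃ a b c d, [a, b, c, d].Sublist w ∧
      ∀ i j : Fin 4, (![a, b, c, d] i < ![a, b, c, d] j ↔ ![t₀, t₁, t₂, t₃] i < ![t₀, t₁, t₂, t₃] j) ∧
        (![a, b, c, d] i > ![a, b, c, d] j ↔ ![t₀, t₁, t₂, t₃] i > ![t₀, t₁, t₂, t₃] j) := by
  constructor
  · rintro ⟨f, hf, h⟩
    refine ⟨w.get (f (0 : Fin 4)), w.get (f (1 : Fin 4)), w.get (f (2 : Fin 4)),
      w.get (f (3 : Fin 4)), ?_, ?_⟩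
    · rw [List.sublist_iff_exists_fin_orderEmbedding_get_eq]
      refine ⟨OrderEmbedding.ofStrictMono f hf, fun i => ?_⟩
      change Fin 4 at i
      fin_cases i <;> rfl
    · intro i j
      have := h i j
      fin_cases i <;> fin_cases j <;> exact this
  · rintro ⟨a, b, c, d, hs, h⟩
    rw [List.sublist_iff_exists_fin_orderEmbedding_get_eq] at hs
    obtain ⟨f, hf⟩ := hs
    refine ⟨f, f.strictMono, fun i j => ?_⟩
    rw [← hf i, ← hf j]
    have := h i j
    change Fin 4 at i j
    fin_cases i <;> fin_cases j <;> exact this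

theorem avoids_0010_0021_iff (w : List ℕ) :
    (∀ τ ∈ [[0, 0, 1, 0], [0, 0, 2, 1]], Avoids w τ) ↔
      ∀ a b c, a ≤ b → a ≤ c → [a, a, b, c].Sublist w → b ≤ c := by
  simp only [List.mem_cons, List.not_mem_nil, or_false, forall_eq_or_imp, forall_eq, Avoids,
    contains_four_iff]
  simp only [Fin.forall_fin_succ, Fin.isValue]
  simp
  constructor
  · rintro ⟨h1, h2⟩ a b c hab hac hs
    by_contra! hcb
    rcases hac.eq_or_lt with rfl | hac
    · have := h1 a a b a hs
      omega
    · have := h2 a a b c hs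
      omega
  · intro h
    refine ⟨fun a b c d hs => ?_, fun a b c d hs => ?_⟩
    · by_contra hc
      obtain rfl : a = b := by omega
      have := h a c d (by omega) (by omega) hs
      omega
    · by_contra hc
      obtain rfl : a = b := by omega
      have := h a c d (by omega) (by omega) hs
      omega

theorem avoids_0011_0021_iff (w : List ℕ) :
    (∀ τ ∈ [[0, 0, 1, 1], [0, 0, 2, 1]], Avoids w τ) ↔
      ∀ a b c, a ≤ b → a < c → [a, a, b, c].Sublist w → b < c := by
  simp only [List.mem_cons, List.not_mem_nil, or_false, forall_eq_or_imp, forall_eq, Avoids,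
    contains_four_iff]
  simp only [Fin.forall_fin_succ, Fin.isValue]
  simp
  constructor
  · rintro ⟨h1, h2⟩ a b c hab hac hs
    by_contra! hcb
    rcases hcb.eq_or_lt with rfl | hcb
    · have := h1 a a c c hs
      omega
    · have := h2 a a b c hs
      omega
  · intro h
    refine ⟨fun a b c d hs => ?_, fun a b c d hs => ?_⟩
    · by_contra hc
      obtain rfl : a = b := by omega
      have := h a c d (by omega) (by omega) hs
      omega
    · by_contra hc
      obtain rfl : a = b := by omega
      have := h a c d (by omega) (by omega) hs
      omega

/-- Ascent sequences avoiding `0010` and `0021`. -/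
def WeakAvoider (w : List ℕ) : Prop :=
  IsAscentSeq w ∧ ∀ a b c, a ≤ b → a ≤ c → [a, a, b, c].Sublist w → b ≤ c

/-- Ascent sequences avoiding `0011` and `0021`. -/
def StrictAvoider (w : List ℕ) : Prop :=
  IsAscentSeq w ∧ ∀ a b c, a ≤ b → a < c → [a, a, b, c].Sublist w → b < c

/-- Appending `z` to `u` creates neither `0010` nor `0021`; equivalently, appending `z + 1`
creates neither `0011` nor `0021`. -/
def Live (u : List ℕ) (z : ℕ) : Prop :=
  ∀ a b, a ≤ b → [a, a, b].Sublist u → a ≤ z → b ≤ z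

theorem weakAvoider_append_singleton {u : List ℕ} (hu : u ≠ []) (x : ℕ) :
    WeakAvoider (u ++ [x]) ↔ WeakAvoider u ∧ x ≤ numAscents u + 1 ∧ Live u x := by
  have key : ∀ a b c, [a, a, b, c].Sublist (u ++ [x]) ↔
      [a, a, b, c].Sublist u ∨ c = x ∧ [a, a, b].Sublist u := fun a b c =>
    append_singleton_sublist_append_singleton (l := [a, a, b])
  simp only [WeakAvoider, isAscentSeq_append_singleton hu, key, Live]
  constructor
  · rintro ⟨⟨h1, h2⟩, h3⟩
    exact ⟨⟨h1, fun a b c hab hac hs => h3 a b c hab hac (.inl hs)⟩, h2,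
      fun a b hab hs hax => h3 a b x hab hax (.inr ⟨rfl, hs⟩)⟩
  · rintro ⟨⟨h1, h2⟩, h3, h4⟩
    refine ⟨⟨h1, h3⟩, ?_⟩
    rintro a b c hab hac (hs | ⟨rfl, hs⟩)
    · exact h2 a b c hab hac hs
    · exact h4 a b hab hs hac

theorem strictAvoider_append_singleton {u : List ℕ} (hu : u ≠ []) (x : ℕ) :
    StrictAvoider (u ++ [x]) ↔
      StrictAvoider u ∧ x ≤ numAscents u + 1 ∧ ∀ z, x = z + 1 → Live u z := by
  have key : ∀ a b c, [a, a, b, c].Sublist (u ++ [x]) ↔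
      [a, a, b, c].Sublist u ∨ c = x ∧ [a, a, b].Sublist u := fun a b c =>
    append_singleton_sublist_append_singleton (l := [a, a, b])
  simp only [StrictAvoider, isAscentSeq_append_singleton hu, key, Live]
  constructor
  · rintro ⟨⟨h1, h2⟩, h3⟩
    refine ⟨⟨h1, fun a b c hab hac hs => h3 a b c hab hac (.inl hs)⟩, h2, ?_⟩
    rintro z rfl a b hab hs haz
    have := h3 a b (z + 1) hab (by omega) (.inr ⟨rfl, hs⟩)
    omega
  · rintro ⟨⟨h1, h2⟩, h3, h4⟩
    refine ⟨⟨h1, h3⟩, ?_⟩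
    rintro a b c hab hac (hs | ⟨rfl, hs⟩)
    · exact h2 a b c hab hac hs
    · have := h4 (c - 1) (by omega) a b hab hs (by omega)
      omega

theorem pair_sublist_append_singleton {u : List ℕ} {a x : ℕ} :
    [a, a].Sublist (u ++ [x]) ↔ [a, a].Sublist u ∨ a = x ∧ x ∈ u := by
  change ([a] ++ [a]).Sublist _ ↔ ([a] ++ [a]).Sublist _ ∨ _
  rw [append_singleton_sublist_append_singleton]
  simp only [List.singleton_append, List.singleton_sublist]
  exact or_congr_right (and_congr_right fun h => by rw [h])

theorem live_append_singleton {u : List ℕ} {x z : ℕ} :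
    Live (u ++ [x]) z ↔ Live u z ∧ ∀ a, [a, a].Sublist u → a ≤ x → a ≤ z → x ≤ z := by
  have key : ∀ a b, [a, a, b].Sublist (u ++ [x]) ↔
      [a, a, b].Sublist u ∨ b = x ∧ [a, a].Sublist u := fun a b =>
    append_singleton_sublist_append_singleton (l := [a, a])
  simp only [Live, key]
  constructor
  · intro h
    exact ⟨fun a b hab hs => h a b hab (.inl hs), fun a hs hax => h a x hax (.inr ⟨rfl, hs⟩)⟩
  · rintro ⟨h1, h2⟩ a b hab (hs | ⟨rfl, hs⟩) haz
    · exact h1 a b hab hs haz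
    · exact h2 a hs hab haz

theorem live_append_singleton_of_isLeast {u : List ℕ} {m x z : ℕ}
    (hm : IsLeast {a | [a, a].Sublist u} m) :
    Live (u ++ [x]) z ↔ Live u z ∧ (m ≤ x → m ≤ z → x ≤ z) := by
  rw [live_append_singleton]
  refine and_congr_right fun _ => ⟨fun h => h m hm.1, fun h a ha hax haz => ?_⟩
  have : m ≤ a := hm.2 ha
  exact h (by omega) (by omega)

theorem live_of_lt {u : List ℕ} {m z : ℕ} (hm : IsLeast {a | [a, a].Sublist u} m) (hz : z < m) :
    Live u z := by
  intro a b _ hs haz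
  have : m ≤ a := hm.2 ((List.sublist_append_left [a, a] [b]).trans hs)
  omega

theorem live_of_forall_le {u : List ℕ} {z : ℕ} (h : ∀ c ∈ u, c ≤ z) : Live u z :=
  fun a b _ hs _ => h b (hs.subset (by simp))

/-- The invariant relating matched prefixes with least repeated letter `m`. -/
structure Matched (u v : List ℕ) (m : ℕ) : Prop where
  least_left : IsLeast {a | [a, a].Sublist u} m
  least_right : IsLeast {a | [a, a].Sublist v} m
  mem_left : ∀ z ≤ m, z ∈ u
  mem_right : ∀ z ≤ m, z ∈ v
  live_iff : ∀ z, Live u z ↔ Live v z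
  asc_eq : numAscents u = numAscents v
  le_asc : ∀ c ∈ u, c ≤ numAscents u
  last : ∃ u' v' p q, u = u' ++ [p] ∧ v = v' ++ [q] ∧ Live u p ∧ m ≤ q ∧ q ≤ p ∧
    ∀ z, m ≤ z → z < p → ¬ Live u z

/-- The letter `x` appended on the weak side corresponds to `y` on the strict side. -/
def Step (u : List ℕ) (m x y : ℕ) : Prop :=
  x < m ∧ y = x ∨ Live u x ∧ m ≤ y ∧ y ≤ x ∧ (∀ z, y ≤ z → z < x → ¬ Live u z) ∧
    (y = m ∨ ∃ z, y = z + 1 ∧ Live u z)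

theorem Step.right_unique {u : List ℕ} {m x y y' : ℕ} (h : Step u m x y) (h' : Step u m x y') :
    y = y' := by
  rcases h with ⟨h1, h2⟩ | ⟨-, h1, h2, h3, h4⟩ <;>
    rcases h' with ⟨h1', h2'⟩ | ⟨-, h1', h2', h3', h4'⟩
  · omega
  · omega
  · omega
  · rcases lt_trichotomy y y' with hlt | heq | hlt
    · rcases h4' with h | ⟨z, rfl, hz⟩
      · omega
      · exact absurd hz (h3 z (by omega) (by omega))
    · exact heq
    · rcases h4 with h | ⟨z, rfl, hz⟩
      · omega
      · exact absurd hz (h3' z (by omega) (by omega))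

theorem Step.left_unique {u : List ℕ} {m x x' y : ℕ} (h : Step u m x y) (h' : Step u m x' y) :
    x = x' := by
  rcases h with ⟨h1, h2⟩ | ⟨h0, h1, h2, h3, h4⟩ <;>
    rcases h' with ⟨h1', h2'⟩ | ⟨h0', h1', h2', h3', h4'⟩
  · omega
  · omega
  · omega
  · rcases lt_trichotomy x x' with hlt | heq | hlt
    · exact absurd h0 (h3' x h2 hlt)
    · exact heq
    · exact absurd h0' (h3 x' h2' hlt)

theorem Step.exists_right (u : List ℕ) (m x : ℕ) (hx : Live u x) : ∃ y, Step u m x y := by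
  classical
  rcases Nat.lt_or_ge x m with hlt | hge
  · exact ⟨x, .inl ⟨hlt, rfl⟩⟩
  · have hex : ∃ y, m ≤ y ∧ ∀ z, y ≤ z → z < x → ¬ Live u z := ⟨x, hge, fun z _ _ => by omega⟩
    have hmin := fun k (hk : k < Nat.find hex) => Nat.find_min hex hk
    obtain ⟨h1, h2⟩ := Nat.find_spec hex
    have hle : Nat.find hex ≤ x := Nat.find_min' hex ⟨hge, fun z _ _ => by omega⟩
    generalize Nat.find hex = y at *
    refine ⟨y, .inr ⟨hx, h1, hle, h2, or_iff_not_imp_left.2 fun hne => ⟨y - 1, by omega, ?_⟩⟩⟩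
    by_contra hdead
    refine hmin (y - 1) (by omega) ⟨by omega, fun z hz hzx => ?_⟩
    rcases hz.eq_or_lt with rfl | hz
    · exact hdead
    · exact h2 z (by omega) hzx

theorem Step.exists_left (u : List ℕ) (m y B : ℕ) (hy : ∀ z, y = z + 1 → Live u z)
    (hyB : y ≤ B) (hB : Live u B) : ∃ x ≤ B, Step u m x y := by
  classical
  rcases Nat.lt_or_ge y m with hlt | hge
  · exact ⟨y, hyB, .inl ⟨hlt, rfl⟩⟩
  · have hex : ∃ x, y ≤ x ∧ Live u x := ⟨B, hyB, hB⟩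
    obtain ⟨h1, h2⟩ := Nat.find_spec hex
    refine ⟨Nat.find hex, Nat.find_min' hex ⟨hyB, hB⟩, .inr ⟨h2, hge, h1, fun z hz hzx hl =>
      Nat.find_min hex hzx ⟨hz, hl⟩, ?_⟩⟩
    rcases hge.eq_or_lt with h | h
    · exact .inl h.symm
    · exact .inr ⟨y - 1, by omega, hy _ (by omega)⟩

theorem Matched.append {u v : List ℕ} {m x y : ℕ} (h : Matched u v m) (hs : Step u m x y)
    (hx : x ≤ numAscents u + 1) : Matched (u ++ [x]) (v ++ [y]) (min m x) := by
  obtain ⟨hlu, hlv, hmu, hmv, hlive, hasc, hle, u', v', p, q, hu, hv, hp, hmq, hqp, hdead⟩ := h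
  have hascu : numAscents (u ++ [x]) = numAscents u + if p < x then 1 else 0 := by
    rw [hu, numAscents_append_pair]
  have hascv : numAscents (v ++ [y]) = numAscents v + if q < y then 1 else 0 := by
    rw [hv, numAscents_append_pair]
  have hple : p ≤ numAscents u := hle p (by simp [hu])
  have hle' : ∀ c ∈ u ++ [x], c ≤ numAscents (u ++ [x]) := by
    intro c hc
    rw [hascu]
    rcases List.mem_append.1 hc with hc | hc
    · have := hle c hc
      omega
    · rw [List.mem_singleton] at hc
      split_ifs <;> omega
  rcases hs with ⟨hxm, rfl⟩ | ⟨hx, hmy, hyx, hgap, hpred⟩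
  · have hmin : min m y = y := by omega
    rw [hmin]
    have hleast : ∀ w : List ℕ, IsLeast {a | [a, a].Sublist w} m → y ∈ w →
        IsLeast {a | [a, a].Sublist (w ++ [y])} y := by
      intro w hw hyw
      refine ⟨pair_sublist_append_singleton.2 (.inr ⟨rfl, hyw⟩), fun a ha => ?_⟩
      rcases pair_sublist_append_singleton.1 ha with ha | ⟨rfl, -⟩
      · have : m ≤ a := hw.2 ha
        omega
      · exact le_rfl
    refine ⟨hleast u hlu (hmu y hxm.le), hleast v hlv (hmv y hxm.le),
      fun z hz => List.mem_append_left _ (hmu z (by omega)),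
      fun z hz => List.mem_append_left _ (hmv z (by omega)), fun z => ?_, ?_, hle',
      u, v, y, y, rfl, rfl, ?_, le_rfl, le_rfl, fun z _ _ => by omega⟩
    · rw [live_append_singleton_of_isLeast hlu, live_append_singleton_of_isLeast hlv, hlive]
    · rw [hascu, hascv, if_neg (by omega), if_neg (by omega), hasc]
    · exact (live_append_singleton_of_isLeast hlu).2 ⟨live_of_lt hlu hxm, fun _ _ => le_rfl⟩
  · have hmin : min m x = m := by omega
    rw [hmin]
    have hleast : ∀ (w : List ℕ) (t : ℕ), m ≤ t → IsLeast {a | [a, a].Sublist w} m →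
        IsLeast {a | [a, a].Sublist (w ++ [t])} m := by
      intro w t ht hw
      refine ⟨pair_sublist_append_singleton.2 (.inl hw.1), fun a ha => ?_⟩
      rcases pair_sublist_append_singleton.1 ha with ha | ⟨rfl, -⟩
      · exact hw.2 ha
      · exact ht
    have hpx : p ≤ x := by
      by_contra! hlt
      exact hdead x (by omega) hlt hx
    refine ⟨hleast u x (by omega) hlu, hleast v y hmy hlv,
      fun z hz => List.mem_append_left _ (hmu z hz),
      fun z hz => List.mem_append_left _ (hmv z hz), fun z => ?_, ?_, hle',
      u, v, x, y, rfl, rfl, ?_, hmy, hyx, fun z hz hzx hl => ?_⟩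
    · rw [live_append_singleton_of_isLeast hlu, live_append_singleton_of_isLeast hlv, ← hlive]
      refine and_congr_right fun hz => ⟨fun h _ hmz => ?_, fun h _ hmz => ?_⟩
      · have := h (by omega) hmz
        omega
      · by_contra! hlt
        exact hgap z (h hmy hmz) hlt hz
    · rw [hascu, hascv, hasc]
      congr 1
      refine if_congr ⟨fun hlt => ?_, fun hlt => ?_⟩ rfl rfl
      · by_contra! hyq
        exact hgap p (by omega) hlt hp
      · rcases hpred with rfl | ⟨z, rfl, hz⟩
        · omega
        · by_contra! hxp
          exact hdead z (by omega) (by omega) hz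
    · exact (live_append_singleton_of_isLeast hlu).2 ⟨hx, fun _ _ => le_rfl⟩
    · have := ((live_append_singleton_of_isLeast hlu).1 hl).2 (by omega) hz
      omega

theorem not_pair_sublist_range (k a : ℕ) : ¬ [a, a].Sublist (List.range k) := fun h => by
  simpa using h.nodup List.nodup_range

theorem live_range (k z : ℕ) : Live (List.range k) z := fun a b _ hs _ =>
  absurd ((List.sublist_append_left [a, a] [b]).trans hs) (not_pair_sublist_range k a)

theorem numAscents_range_succ (k : ℕ) : numAscents (List.range (k + 1)) = k := by
  induction k with
  | zero => rfl
  | succ k ih =>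
    rw [List.range_succ, List.range_succ, numAscents_append_pair, ← List.range_succ, ih]
    simp

theorem matched_range_append {k x : ℕ} (hx : x ≤ k) :
    Matched (List.range (k + 1) ++ [x]) (List.range (k + 1) ++ [x]) x := by
  have hlive : ∀ z, Live (List.range (k + 1) ++ [x]) z := fun z =>
    live_append_singleton.2 ⟨live_range _ _, fun a ha => absurd ha (not_pair_sublist_range _ _)⟩
  have hleast : IsLeast {a | [a, a].Sublist (List.range (k + 1) ++ [x])} x := by
    refine ⟨pair_sublist_append_singleton.2 (.inr ⟨rfl, by simp; omega⟩), fun a ha => ?_⟩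
    rcases pair_sublist_append_singleton.1 ha with ha | ⟨rfl, -⟩
    · exact absurd ha (not_pair_sublist_range _ _)
    · exact le_rfl
  have hmem : ∀ z ≤ x, z ∈ List.range (k + 1) ++ [x] := fun z hz => by simp; omega
  refine ⟨hleast, hleast, hmem, hmem, fun _ => Iff.rfl, rfl, fun c hc => ?_,
    _, _, x, x, rfl, rfl, hlive x, le_rfl, le_rfl, fun z _ _ => by omega⟩
  have hasc : numAscents (List.range (k + 1) ++ [x]) = k := by
    conv_lhs => rw [List.range_succ, numAscents_append_pair, ← List.range_succ,
      numAscents_range_succ, if_neg (by omega)]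
    rfl
  rw [hasc]
  simp at hc
  omega

theorem exists_equiv_of_rel {α β : Type*} (r : α → β → Prop) (hl : ∀ a, ∃ b, r a b)
    (hr : ∀ b, ∃ a, r a b) (hru : ∀ a b b', r a b → r a b' → b = b')
    (hlu : ∀ a a' b, r a b → r a' b → a = a') : ∃ e : α ≃ β, ∀ a, r a (e a) := by
  choose f hf using hl
  choose g hg using hr
  exact ⟨⟨f, g, fun a => hlu _ _ _ (hg _) (hf a), fun b => hru _ _ _ (hf _) (hg b)⟩, hf⟩

/-- Words `u` and `v` are matched when both are the same initial run `0, 1, …, k`, or when they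
are matched with respect to their least repeated letter. -/
def Related (u v : List ℕ) : Prop :=
  (∃ k, u = List.range (k + 1) ∧ v = List.range (k + 1)) ∨ ∃ m, Matched u v m

theorem Related.ne_nil {u v : List ℕ} (h : Related u v) : u ≠ [] ∧ v ≠ [] := by
  rcases h with ⟨k, rfl, rfl⟩ | ⟨m, h⟩
  · simp
  · obtain ⟨u', v', p, q, rfl, rfl, -⟩ := h.last
    simp

theorem Related.asc_eq {u v : List ℕ} (h : Related u v) : numAscents u = numAscents v := by
  rcases h with ⟨k, rfl, rfl⟩ | ⟨m, h⟩
  · rfl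
  · exact h.asc_eq

theorem Related.exists_equiv {u v : List ℕ} (h : Related u v) (hu : WeakAvoider u)
    (hv : StrictAvoider v) :
    ∃ e : {x // WeakAvoider (u ++ [x])} ≃ {y // StrictAvoider (v ++ [y])},
      ∀ x, Related (u ++ [x.1]) (v ++ [(e x).1]) := by
  obtain ⟨hun, hvn⟩ := h.ne_nil
  have hweak : ∀ x, WeakAvoider (u ++ [x]) ↔ x ≤ numAscents u + 1 ∧ Live u x := fun x => by
    rw [weakAvoider_append_singleton hun, and_iff_right hu]
  have hstrict : ∀ y, StrictAvoider (v ++ [y]) ↔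
      y ≤ numAscents v + 1 ∧ ∀ z, y = z + 1 → Live v z := fun y => by
    rw [strictAvoider_append_singleton hvn, and_iff_right hv]
  rcases h with ⟨k, rfl, rfl⟩ | ⟨m, h⟩
  · simp only [live_range, implies_true, and_true, numAscents_range_succ] at hweak hstrict
    refine ⟨Equiv.subtypeEquivRight fun x => (hweak x).trans (hstrict x).symm, fun ⟨x, hx⟩ => ?_⟩
    rcases ((hweak x).1 hx).eq_or_lt with rfl | hlt
    · exact .inl ⟨k + 1, by simp [List.range_succ], by simp [List.range_succ]⟩
    · exact .inr ⟨x, matched_range_append (Nat.lt_succ_iff.1 hlt)⟩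
  · have hlast : Live u (numAscents u + 1) :=
      live_of_forall_le fun c hc => (h.le_asc c hc).trans (Nat.le_succ _)
    have hright : ∀ x : {x // WeakAvoider (u ++ [x])},
        ∃ y : {y // StrictAvoider (v ++ [y])}, Step u m x.1 y.1 := by
      rintro ⟨x, hx⟩
      obtain ⟨hx, hxl⟩ := (hweak x).1 hx
      obtain ⟨y, hy⟩ := Step.exists_right u m x hxl
      refine ⟨⟨y, (hstrict y).2 ⟨?_, ?_⟩⟩, hy⟩
      · rw [← h.asc_eq]
        rcases hy with ⟨-, rfl⟩ | ⟨-, -, hyx, -⟩ <;> omega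
      · rintro z rfl
        rw [← h.live_iff]
        rcases hy with ⟨hm, rfl⟩ | ⟨-, -, -, -, rfl | ⟨z', hz', hl⟩⟩
        · exact live_of_lt h.least_left (by omega)
        · exact live_of_lt h.least_left (by omega)
        · obtain rfl : z = z' := by omega
          exact hl
    have hleft : ∀ y : {y // StrictAvoider (v ++ [y])},
        ∃ x : {x // WeakAvoider (u ++ [x])}, Step u m x.1 y.1 := by
      rintro ⟨y, hy⟩
      obtain ⟨hy, hyl⟩ := (hstrict y).1 hy
      obtain ⟨x, hx, hxy⟩ := Step.exists_left u m y _ (fun z hz => (h.live_iff z).2 (hyl z hz))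
        (h.asc_eq ▸ hy) hlast
      refine ⟨⟨x, (hweak x).2 ⟨hx, ?_⟩⟩, hxy⟩
      rcases hxy with ⟨hm, -⟩ | ⟨hl, -⟩
      · exact live_of_lt h.least_left hm
      · exact hl
    obtain ⟨e, he⟩ := exists_equiv_of_rel _ hright hleft
      (fun _ _ _ hab hab' => Subtype.ext (hab.right_unique hab'))
      (fun _ _ _ hab hab' => Subtype.ext (hab.left_unique hab'))
    exact ⟨e, fun x => .inr ⟨_, h.append (he x) ((hweak _).1 x.2).1⟩⟩

theorem WeakAvoider.of_append {u : List ℕ} (hu : u ≠ []) (w : List ℕ)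
    (h : WeakAvoider (u ++ w)) : WeakAvoider u := by
  induction w using List.reverseRecOn with
  | nil => simpa using h
  | append_singleton w x ih =>
    rw [← List.append_assoc, weakAvoider_append_singleton (by simp [hu])] at h
    exact ih h.1

theorem StrictAvoider.of_append {u : List ℕ} (hu : u ≠ []) (w : List ℕ)
    (h : StrictAvoider (u ++ w)) : StrictAvoider u := by
  induction w using List.reverseRecOn with
  | nil => simpa using h
  | append_singleton w x ih =>
    rw [← List.append_assoc, strictAvoider_append_singleton (by simp [hu])] at h
    exact ih h.1

/-- Continuations of `u` of length `r` within `P`, ending with `t` ascents in total. -/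
def Continuation (P : List ℕ → Prop) (t r : ℕ) (u : List ℕ) : Type :=
  {w : List ℕ // w.length = r ∧ P (u ++ w) ∧ numAscents (u ++ w) = t}

/-- Splitting off the first letter of a continuation. -/
def continuationSuccEquiv (P : List ℕ → Prop) (t r : ℕ) (u : List ℕ)
    (hP : ∀ x w, P (u ++ [x] ++ w) → P (u ++ [x])) :
    Continuation P t (r + 1) u ≃ Σ x : {x // P (u ++ [x])}, Continuation P t r (u ++ [x.1]) where
  toFun
    | ⟨x :: w, h⟩ => ⟨⟨x, hP x w (by simpa using h.2.1)⟩, w, by simpa using h⟩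
  invFun s := ⟨s.1.1 :: s.2.1, by simpa using s.2.2⟩
  left_inv
    | ⟨_ :: _, _⟩ => rfl
  right_inv _ := rfl

theorem Related.nonempty_continuation_equiv (t r : ℕ) {u v : List ℕ} (h : Related u v)
    (hu : WeakAvoider u) (hv : StrictAvoider v) :
    Nonempty (Continuation WeakAvoider t r u ≃ Continuation StrictAvoider t r v) := by
  induction r generalizing u v with
  | zero =>
    refine ⟨Equiv.subtypeEquivRight fun w => and_congr_right fun hw => ?_⟩
    obtain rfl := List.length_eq_zero_iff.1 hw
    simp [hu, hv, h.asc_eq]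
  | succ r ih =>
    obtain ⟨e, he⟩ := h.exists_equiv hu hv
    exact ⟨(continuationSuccEquiv _ t r u fun x w => WeakAvoider.of_append (by simp) w).trans <|
      (Equiv.sigmaCongr e fun x => (ih (he x) x.2 (e x).2).some).trans
        (continuationSuccEquiv _ t r v fun x w => StrictAvoider.of_append (by simp) w).symm⟩

theorem ncard_eq_card_continuation (P : List ℕ → Prop) (hP : ∀ w, P w → w.head? = some 0)
    (t r : ℕ) : {w : List ℕ | w.length = r + 1 ∧ P w ∧ numAscents w = t}.ncard =
      Nat.card (Continuation P t r [0]) := by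
  have himage : {w : List ℕ | w.length = r + 1 ∧ P w ∧ numAscents w = t} =
      (0 :: ·) '' {w : List ℕ | w.length = r ∧ P ([0] ++ w) ∧ numAscents ([0] ++ w) = t} := by
    ext w
    constructor
    · rintro ⟨h1, h2, h3⟩
      cases w with
      | nil => simp at h1
      | cons a w =>
        obtain rfl : a = 0 := by simpa using hP _ h2
        exact ⟨w, ⟨by simpa using h1, h2, h3⟩, rfl⟩
    · rintro ⟨w, ⟨h1, h2, h3⟩, rfl⟩
      exact ⟨by simpa using h1, h2, h3⟩
  rw [himage, Set.ncard_image_of_injective _ List.cons_injective, ← Nat.card_coe_set_eq]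
  rfl

/-- `S_{n,m}(0010,0021) = S_{n,m}(0011,0021)`. -/
theorem avoiderCountAsc_0010_0021_eq_0011_0021 (n m : ℕ) (hn : 1 ≤ n) (hm : m < n) :
    avoiderCountAsc n m [[0,0,1,0], [0,0,2,1]] = avoiderCountAsc n m [[0,0,1,1], [0,0,2,1]] := by
  obtain ⟨r, rfl⟩ : ∃ r, n = r + 1 := ⟨n - 1, by omega⟩
  have hzero : IsAscentSeq [0] := ⟨rfl, fun i hi h1 => by simp at hi; omega⟩
  have hshort : ∀ a b c, ¬ [a, a, b, c].Sublist [0] := fun a b c h => by simpa using h.length_le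
  have hrel : Related [0] [0] := .inl ⟨0, rfl, rfl⟩
  obtain ⟨e⟩ := hrel.nonempty_continuation_equiv m r
    ⟨hzero, fun a b c _ _ h => absurd h (hshort a b c)⟩
    ⟨hzero, fun a b c _ _ h => absurd h (hshort a b c)⟩
  have hleft := ncard_eq_card_continuation WeakAvoider (fun w h => h.1.1) m r
  have hright := ncard_eq_card_continuation StrictAvoider (fun w h => h.1.1) m r
  have hcard := hleft.trans ((Nat.card_congr e).trans hright.symm)
  unfold avoiderCountAsc
  simp only [avoids_0010_0021_iff, avoids_0011_0021_iff]
  convert hcard using 3 <;> simp only [WeakAvoider, StrictAvoider] <;> ext w <;> tauto
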